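/- Under the right-spinor Dirac setup: (i) the chiral current is lightlike, i.e. (j⁰)² = (j¹)² + (j²)² + (j³)² everywhere on ℝ⁴; (ii) at every point where j⁰ ≠ 0, setting ρ := j⁰, v^k := j^k/j⁰ and p_n := T_n^0, one has T_n^l = p_n·v^l + ½·ρ·Σ_{k,o=1}^{3} ε_{lko}·v^k·∂_n v^o for all l, n ∈ {1,2,3}, where ε is the standard Levi-Civita symbol with ε₁₂₃ = 1. -/

import Mathlib

open Matrix

noncomputable section

/-- The space algebra `Cl(3)` represented as `M₂(ℂ)`. -/
abbrev M2 : Type := Matrix (Fin 2) (Fin 2) ℂ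

/-- Spacetime `ℝ⁴`. -/
abbrev R4 : Type := Fin 4 → ℝ

/-- Basis paravectors: `e 0 = 1` and the Pauli matrices. -/
def e : Fin 4 → M2 :=
  ![1, !![0, 1; 1, 0], !![0, -Complex.I; Complex.I, 0], !![1, 0; 0, -1]]

/-- Dual basis paravectors: `edual 0 = 1` and `edual k = - e k` for `k = 1,2,3`. -/
def edual : Fin 4 → M2 :=
  ![1, -e 1, -e 2, -e 3]

/-- The grade automorphism `M̂ = (adj M)†`. -/
def gradeAut (M : M2) : M2 := (M.adjugate)ᴴ

/-- The projector `P = ½(1+e₃)`. -/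
def P : M2 := !![1, 0; 0, 0]

/-- The projector `P̄ = ½(1-e₃)`. -/
def Pbar : M2 := !![0, 0; 0, 1]

/-- Partial derivative `∂_μ` of a complex-valued function on `ℝ⁴`. -/
def pdC (μ : Fin 4) (f : R4 → ℂ) (x : R4) : ℂ := fderiv ℝ f x (Pi.single μ 1)

/-- Partial derivative `∂_μ` of a real-valued function on `ℝ⁴`. -/
def pdR (μ : Fin 4) (f : R4 → ℝ) (x : R4) : ℝ := fderiv ℝ f x (Pi.single μ 1)

/-- Entrywise partial derivative `∂_μ` of an `M₂(ℂ)`-valued function on `ℝ⁴`. -/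
def pdM (μ : Fin 4) (f : R4 → M2) (x : R4) : M2 :=
  Matrix.of fun i j => pdC μ (fun y => f y i j) x

/-- Components of the chiral current `𝔧 = φ·P̄·φ†`: `j^μ = ½ tr(𝔧 * e μ)`
(note `e 0 = 1`). -/
def jComp (φ : R4 → M2) (μ : Fin 4) (x : R4) : ℂ :=
  (1/2) * (φ x * Pbar * (φ x)ᴴ * e μ).trace

/-- Tétrode's energy-momentum tensor `T_ν^μ`. -/
def TComp (Γ : Fin 4 → R4 → ℝ) (φ : R4 → M2) (ν μ : Fin 4) (x : R4) : ℂ :=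
  -(Complex.I / 4) *
      (edual μ *
        (pdM ν (fun y => gradeAut (φ y)) x * P * (φ x).adjugate
          - gradeAut (φ x) * P * pdM ν (fun y => (φ y).adjugate) x)).trace
    + (Γ ν x : ℂ) * jComp φ μ x

/-- The Levi-Civita symbol on `{1,2,3}` (indexed by `Fin 3`), with `ε 0 1 2 = 1`. -/
def eps : Fin 3 → Fin 3 → Fin 3 → ℝ := fun i j k =>
  if (i, j, k) = (0, 1, 2) ∨ (i, j, k) = (1, 2, 0) ∨ (i, j, k) = (2, 0, 1) then 1
  else if (i, j, k) = (2, 1, 0) ∨ (i, j, k) = (1, 0, 2) ∨ (i, j, k) = (0, 2, 1) then -1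
  else 0

lemma pdC_star (μ : Fin 4) (f : R4 → ℂ) (x : R4) (hf : DifferentiableAt ℝ f x) :
    pdC μ (fun y => star (f y)) x = star (pdC μ f x) := by
  unfold pdC
  rw [show (fun y => star (f y)) = (fun y => Complex.conjCLE (f y)) from rfl]
  have := (Complex.conjCLE.toContinuousLinearMap.hasFDerivAt.comp x hf.hasFDerivAt).fderiv
  exact congrArg (fun L => L (Pi.single μ 1)) this

lemma pdC_neg (μ : Fin 4) (f : R4 → ℂ) (x : R4) :
    pdC μ (fun y => - (f y)) x = - (pdC μ f x) := by
  unfold pdC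
  rw [fderiv_fun_neg]; rfl

lemma pdC_add (μ : Fin 4) (f g : R4 → ℂ) (x : R4) (hf : DifferentiableAt ℝ f x)
    (hg : DifferentiableAt ℝ g x) :
    pdC μ (fun y => f y + g y) x = pdC μ f x + pdC μ g x := by
  unfold pdC
  rw [fderiv_fun_add hf hg]; rfl

lemma pdC_mul (μ : Fin 4) (f g : R4 → ℂ) (x : R4) (hf : DifferentiableAt ℝ f x)
    (hg : DifferentiableAt ℝ g x) :
    pdC μ (fun y => f y * g y) x = f x * pdC μ g x + g x * pdC μ f x := by
  unfold pdC
  rw [fderiv_fun_mul hf hg]; rfl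

lemma pdC_const_mul (μ : Fin 4) (c : ℂ) (g : R4 → ℂ) (x : R4)
    (hg : DifferentiableAt ℝ g x) :
    pdC μ (fun y => c * g y) x = c * pdC μ g x := by
  unfold pdC
  rw [fderiv_const_mul hg]; rfl

lemma pdC_div (μ : Fin 4) (f g : R4 → ℂ) (x : R4) (hf : DifferentiableAt ℝ f x)
    (hg : DifferentiableAt ℝ g x) (h0 : ∀ y, g y ≠ 0) :
    pdC μ (fun y => f y / g y) x = (pdC μ f x * g x - f x * pdC μ g x) / (g x) ^ 2 := by
  have hq : DifferentiableAt ℝ (fun y => f y / g y) x := by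
    simp only [div_eq_mul_inv]
    exact hf.mul (hg.inv (h0 x))
  have h := pdC_mul μ (fun y => f y / g y) g x hq hg
  have e1 : (fun y => f y / g y * g y) = f := by
    funext y; exact div_mul_cancel₀ _ (h0 y)
  rw [e1] at h
  have := h0 x
  rw [h]
  field_simp
  ring

lemma jc0 (φ : R4 → M2) : jComp φ 0 = fun x => (1/2) * (φ x 0 1 * star (φ x 0 1) + φ x 1 1 * star (φ x 1 1)) := by
  funext x
  simp [jComp, e, Pbar, Matrix.trace, Matrix.mul_apply, Fin.sum_univ_two]

lemma jc1 (φ : R4 → M2) : jComp φ 1 = fun x => (1/2) * (φ x 0 1 * star (φ x 1 1) + φ x 1 1 * star (φ x 0 1)) := by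
  funext x
  simp [jComp, e, Pbar, Matrix.trace, Matrix.mul_apply, Fin.sum_univ_two]

lemma jc2 (φ : R4 → M2) : jComp φ 2 = fun x => (Complex.I/2) * (φ x 0 1 * star (φ x 1 1) + -(φ x 1 1 * star (φ x 0 1))) := by
  funext x
  simp [jComp, e, Pbar, Matrix.trace, Matrix.mul_apply, Fin.sum_univ_two]
  ring

lemma jc3 (φ : R4 → M2) : jComp φ 3 = fun x => (1/2) * (φ x 0 1 * star (φ x 0 1) + -(φ x 1 1 * star (φ x 1 1))) := by
  funext x
  simp [jComp, e, Pbar, Matrix.trace, Matrix.mul_apply, Fin.sum_univ_two]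

/-- Derivative of a sesquilinear expression. -/
lemma pdC_sesq (μ : Fin 4) (c : ℂ) (p q r s : R4 → ℂ) (x : R4) (hp : DifferentiableAt ℝ p x)
    (hq : DifferentiableAt ℝ q x) (hr : DifferentiableAt ℝ r x) (hs : DifferentiableAt ℝ s x) :
    DifferentiableAt ℝ (fun y => c * (p y * star (q y) + r y * star (s y))) x ∧
    DifferentiableAt ℝ (fun y => c * (p y * star (q y) + -(r y * star (s y)))) x ∧
    pdC μ (fun y => c * (p y * star (q y) + r y * star (s y))) x =
      c * (p x * star (pdC μ q x) + star (q x) * pdC μ p x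
        + (r x * star (pdC μ s x) + star (s x) * pdC μ r x)) ∧
    pdC μ (fun y => c * (p y * star (q y) + -(r y * star (s y)))) x =
      c * (p x * star (pdC μ q x) + star (q x) * pdC μ p x
        + -(r x * star (pdC μ s x) + star (s x) * pdC μ r x)) := by
  have hq' : DifferentiableAt ℝ (fun y => star (q y)) x := hq.star
  have hs' : DifferentiableAt ℝ (fun y => star (s y)) x := hs.star
  have h1 : DifferentiableAt ℝ (fun y => p y * star (q y)) x := hp.mul hq'
  have h2 : DifferentiableAt ℝ (fun y => r y * star (s y)) x := hr.mul hs'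
  have h3 : DifferentiableAt ℝ (fun y => -(r y * star (s y))) x := h2.neg
  refine ⟨(h1.add h2).const_mul c, (h1.add h3).const_mul c, ?_, ?_⟩
  · rw [pdC_const_mul _ _ _ _ (h1.fun_add h2), pdC_add _ _ _ _ h1 h2, pdC_mul _ _ _ _ hp hq',
      pdC_mul _ _ _ _ hr hs', pdC_star _ _ _ hq, pdC_star _ _ _ hs]
  · rw [pdC_const_mul _ _ _ _ (h1.fun_add h3), pdC_add _ _ _ _ h1 h3, pdC_neg, pdC_mul _ _ _ _ hp hq',
      pdC_mul _ _ _ _ hr hs', pdC_star _ _ _ hq, pdC_star _ _ _ hs]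

/-- Matrix of the kinetic part. -/
lemma T_inner (φ : R4 → M2) (hd : ∀ i j x, DifferentiableAt ℝ (fun x => φ x i j) x)
    (ν : Fin 4) (x : R4) (b d b' d' : ℂ) (hb : φ x 0 1 = b) (hdd : φ x 1 1 = d)
    (hb' : pdC ν (fun y => φ y 0 1) x = b') (hd' : pdC ν (fun y => φ y 1 1) x = d') :
    pdM ν (fun y => gradeAut (φ y)) x * P * (φ x).adjugate
          - gradeAut (φ x) * P * pdM ν (fun y => (φ y).adjugate) x
    = !![star d' * d - star d * d', -(star d' * b) + star d * b';
         -(star b' * d) + star b * d', star b' * b - star b * b'] := by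
  have hs : ∀ i j, pdC ν (fun y => star (φ y i j)) x = star (pdC ν (fun y => φ y i j) x) :=
    fun i j => pdC_star _ _ _ (hd i j x)
  simp only [← starRingEnd_apply] at hs
  ext i j
  fin_cases i <;> fin_cases j <;>
    simp [pdM, gradeAut, P, Matrix.mul_apply, Fin.sum_univ_two, Matrix.adjugate_fin_two,
      pdC_neg, hs, hb, hdd, hb', hd'] <;> ring

/-- (i) The chiral current is lightlike; (ii) expression of the spatial part of the
energy-momentum tensor in terms of density, velocity and momentum (assuming `j⁰` is
nonvanishing everywhere). -/
theorem chiral_current_lightlike_and_T_expression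
    (Γ : Fin 4 → R4 → ℝ) (hΓ : ∀ μ, ContDiff ℝ (⊤ : ℕ∞) (Γ μ))
    (φ : R4 → M2) (hφ : ∀ i j, ContDiff ℝ (⊤ : ℕ∞) (fun x => φ x i j))
    (hDirac : ∀ x : R4,
      (∑ μ : Fin 4, edual μ * pdM μ (fun y => gradeAut (φ y) * P) x)
        + Complex.I • ((∑ μ : Fin 4, (Γ μ x : ℂ) • edual μ) * (gradeAut (φ x) * P)) = 0) :
    (∀ x : R4, (jComp φ 0 x) ^ 2 = ∑ k : Fin 3, (jComp φ k.succ x) ^ 2) ∧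
    ((∀ x : R4, jComp φ 0 x ≠ 0) →
      ∀ x : R4, ∀ l n : Fin 3,
        TComp Γ φ n.succ l.succ x
          = TComp Γ φ n.succ 0 x * (jComp φ l.succ x / jComp φ 0 x)
            + (1/2) * jComp φ 0 x *
                ∑ k : Fin 3, ∑ o : Fin 3,
                  (eps l k o : ℂ) * (jComp φ k.succ x / jComp φ 0 x) *
                    pdC n.succ (fun y => jComp φ o.succ y / jComp φ 0 y) x) := by
  have hd : ∀ i j x, DifferentiableAt ℝ (fun x => φ x i j) x := fun i j x =>
    ((hφ i j).differentiable (by simp)).differentiableAt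
  have e1 : (0 : Fin 3).succ = (1 : Fin 4) := rfl
  have e2 : (1 : Fin 3).succ = (2 : Fin 4) := rfl
  have e3 : (2 : Fin 3).succ = (3 : Fin 4) := rfl
  constructor
  · intro x
    simp only [Fin.sum_univ_three, e1, e2, e3, jc0, jc1, jc2, jc3]
    ring_nf
    simp only [Complex.I_sq]
    ring
  · intro h0 x l n
    have hD := h0 x
    obtain ⟨k00, -, k0, -⟩ := pdC_sesq n.succ (1/2) _ _ _ _ x (hd 0 1 x) (hd 0 1 x) (hd 1 1 x) (hd 1 1 x)
    obtain ⟨k11, -, k1, -⟩ := pdC_sesq n.succ (1/2) _ _ _ _ x (hd 0 1 x) (hd 1 1 x) (hd 1 1 x) (hd 0 1 x)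
    obtain ⟨-, k22, -, k2⟩ := pdC_sesq n.succ (Complex.I/2) _ _ _ _ x (hd 0 1 x) (hd 1 1 x) (hd 1 1 x) (hd 0 1 x)
    obtain ⟨-, k33, -, k3⟩ := pdC_sesq n.succ (1/2) _ _ _ _ x (hd 0 1 x) (hd 0 1 x) (hd 1 1 x) (hd 1 1 x)
    rw [← jc0] at k00 k0
    rw [← jc1] at k11 k1
    rw [← jc2] at k22 k2
    rw [← jc3] at k33 k3
    have q1 := pdC_div n.succ _ _ x k11 k00 h0
    have q2 := pdC_div n.succ _ _ x k22 k00 h0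
    have q3 := pdC_div n.succ _ _ x k33 k00 h0
    rw [k0, k1] at q1
    rw [k0, k2] at q2
    rw [k0, k3] at q3
    have t := T_inner φ hd n.succ x _ _ _ _ rfl rfl rfl rfl
    have j0 := congrFun (jc0 φ) x
    have j1 := congrFun (jc1 φ) x
    have j2 := congrFun (jc2 φ) x
    have j3 := congrFun (jc3 φ) x
    simp only [TComp, t, Fin.sum_univ_three, e1, e2, e3, q1, q2, q3]
    generalize Γ n.succ x = g
    generalize pdC n.succ (fun y => φ y 0 1) x = b' at *
    generalize pdC n.succ (fun y => φ y 1 1) x = d' at *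
    generalize φ x 0 1 = b at *
    generalize φ x 1 1 = d at *
    clear q1 q2 q3 k0 k1 k2 k3 k00 k11 k22 k33 t
    generalize star b' = B' at *
    generalize star d' = D' at *
    generalize star b = B at *
    generalize star d = D at *
    have hN : b * B + d * D ≠ 0 := by
      intro h; apply hD; rw [j0, h]; simp
    have hN2 : B * b + d * D ≠ 0 := by rwa [mul_comm B b]
    have hN3 : b * B + D * d ≠ 0 := by rwa [mul_comm D d]
    have hN4 : B * b + D * d ≠ 0 := by rwa [mul_comm D d]
    have hI : Complex.I ^ 2 = -1 := Complex.I_sq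
    have hI3 : Complex.I ^ 3 = -Complex.I := by rw [pow_succ, hI]; ring
    have hI4 : Complex.I ^ 4 = 1 := Complex.I_pow_four
    fin_cases l <;>
    simp [eps, e1, e2, e3, j0, j1, j2, j3, edual, e, Matrix.trace, Matrix.mul_apply, Fin.sum_univ_two] <;>
    field_simp <;> ring_nf <;> (try simp only [hI, hI3, hI4]) <;> ring
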